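/- arXiv:1902.01523 — 9 statements merged into one kernel-verified Lean document; each statement's English description precedes it below -/
import Mathlib

section
/- Every partial marking φ' of the complete oriented graph Γ_r can be extended to a marking φ of Γ_r, i.e. there exists a marking φ : E → K₀ˣ with φ(e) = φ'(e) for every e ∈ E'. -/
open scoped BigOperators

/-- The list of (cyclically consecutive) oriented edges of the closed walk through the
vertices listed in `l`. -/
def cycleEdges {r : ℕ} (l : List (Fin r)) : List (Fin r × Fin r) := l.zip (l.rotate 1)

/-- `l` is an oriented cycle in the complete oriented graph `Γ_r` on the vertex set `Fin r`:
a cyclically ordered list of at least two pairwise distinct vertices. -/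
def IsCycle {r : ℕ} (l : List (Fin r)) : Prop := 2 ≤ l.length ∧ l.Nodup

/-- `φ(C)`: the product of `φ(e)` over all edges `e` of the oriented cycle given by `l`. -/
def cycleProd {K₀ : Type*} [Field K₀] {r : ℕ} (φ : Fin r → Fin r → K₀ˣ)
    (l : List (Fin r)) : K₀ˣ :=
  ((cycleEdges l).map fun q => φ q.1 q.2).prod

theorem cycleEdges_map_range {r : ℕ} (f : ℕ → Fin r) (m : ℕ) :
    cycleEdges ((List.range (m + 1)).map f) =
      (List.range m).map (fun k => (f k, f (k + 1))) ++ [(f m, f 0)] := by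
  have hrot : ((List.range (m + 1)).map f).rotate 1 =
      (List.range m).map (fun k => f (k + 1)) ++ [f 0] := by
    rw [List.range_succ_eq_map]
    simp [Function.comp_def]
  rw [cycleEdges, hrot, List.range_succ, List.map_append, List.zip_append (by simp),
    List.zip_map']
  simp

theorem cycleProd_map_range {K₀ : Type*} [Field K₀] {r : ℕ} (φ : Fin r → Fin r → K₀ˣ)
    (f : ℕ → Fin r) (m : ℕ) :
    cycleProd φ ((List.range (m + 1)).map f) =
      (∏ k ∈ Finset.range m, φ (f k) (f (k + 1))) * φ (f m) (f 0) := by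
  rw [cycleProd, cycleEdges_map_range, List.map_append, List.prod_append, List.map_map,
    ← List.prod_toFinset _ List.nodup_range, List.toFinset_range]
  simp

/-- Every nonempty list is listed by a sequence whose period is the length of the list. -/
theorem exists_periodic_map_range {α : Type*} (l : List α) (hl : 0 < l.length) :
    ∃ f : ℕ → α, (∀ k, f (k + l.length) = f k) ∧ l = (List.range l.length).map f := by
  refine ⟨fun k => l[k % l.length]'(Nat.mod_lt _ hl), fun k => by simp, ?_⟩
  refine List.ext_getElem (by simp) fun i h _ => ?_
  simp [Nat.mod_eq_of_lt h]

theorem cycleProd_div {K₀ : Type*} [Field K₀] {r : ℕ} (p : Fin r → K₀ˣ) (l : List (Fin r))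
    (hl : 0 < l.length) : cycleProd (fun u v => p v / p u) l = 1 := by
  obtain ⟨f, -, hf⟩ := exists_periodic_map_range l hl
  obtain ⟨m, hm⟩ := Nat.exists_eq_add_of_lt hl
  rw [hm, zero_add] at hf
  rw [hf, cycleProd_map_range, Finset.prod_range_div (fun k => p (f k))]
  simp

/-- Lemma `elem`. Let `E'` be a set of edges of the complete oriented graph
`Γ_r` such that some oriented cycle passing through all the vertices of `Γ_r` has all its
edges in `E'`. Then every partial marking `φ'` defined on `E'` extends to a marking `φ` of
`Γ_r`: a function on all edges whose product along every oriented cycle is `1`, agreeing with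
`φ'` on `E'`. -/
theorem partial_marking_extends
    (K₀ : Type*) [Field K₀] {r : ℕ}
    (E' : Set (Fin r × Fin r)) (hE' : ∀ q ∈ E', q.1 ≠ q.2)
    (hham : ∃ l : List (Fin r), IsCycle l ∧ (∀ v : Fin r, v ∈ l) ∧
      ∀ q ∈ cycleEdges l, q ∈ E')
    (φ' : Fin r → Fin r → K₀ˣ)
    (hφ' : ∀ l : List (Fin r), IsCycle l → (∀ q ∈ cycleEdges l, q ∈ E') →
      cycleProd φ' l = 1) :
    ∃ φ : Fin r → Fin r → K₀ˣ,
      (∀ l : List (Fin r), IsCycle l → cycleProd φ l = 1) ∧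
      ∀ q ∈ E', φ q.1 q.2 = φ' q.1 q.2 := by
  obtain ⟨l, hl, hmem, hedge⟩ := hham
  have hpos : 0 < l.length := by have := hl.1; omega
  obtain ⟨w, hper, hw⟩ := exists_periodic_map_range l hpos
  have hprod := hφ' l hl hedge
  have hnodup := hl.2
  obtain ⟨m, hm⟩ := Nat.exists_eq_add_of_lt hpos
  rw [zero_add] at hm
  rw [hm] at hper hw
  rw [hw, cycleEdges_map_range] at hedge
  rw [hw, cycleProd_map_range] at hprod
  have hw0 : w (m + 1) = w 0 := by simpa using hper 0
  have hmod (k : ℕ) : w (k % (m + 1)) = w k := Function.Periodic.map_mod_nat hper k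
  have hinj (i j : ℕ) (hij : w i = w j) : i % (m + 1) = j % (m + 1) := by
    rw [hw] at hnodup
    refine List.inj_on_of_nodup_map hnodup ?_ ?_ (by rw [hmod, hmod, hij]) <;>
      exact List.mem_range.2 (Nat.mod_lt _ m.succ_pos)
  have hstep (k : ℕ) : (w k, w (k + 1)) ∈ E' := by
    have hk : w (k + 1) = w (k % (m + 1) + 1) := by
      rw [← hmod (k + 1), ← hmod (k % (m + 1) + 1)]
      simp
    rw [hk, ← hmod k]
    apply hedge
    have hlt := Nat.mod_lt k m.succ_pos
    rcases Nat.lt_succ_iff_lt_or_eq.1 hlt with h | h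
    · exact List.mem_append_left _ (List.mem_map.2 ⟨_, List.mem_range.2 h, rfl⟩)
    · rw [h, hw0]
      simp
  set P : ℕ → K₀ˣ := fun k => ∏ i ∈ Finset.range k, φ' (w i) (w (i + 1)) with hP
  have hPper : Function.Periodic P (m + 1) := by
    intro k
    have h1 : ∏ i ∈ Finset.range (m + 1), φ' (w i) (w (i + 1)) = 1 := by
      rw [Finset.prod_range_succ, hw0, hprod]
    simp only [hP]
    rw [add_comm k, Finset.prod_range_add, h1, one_mul]
    refine Finset.prod_congr rfl fun i _ => ?_
    rw [add_comm (m + 1) i, hper, add_right_comm, hper]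
  have hsurj (v : Fin r) : ∃ k, k < m + 1 ∧ w k = v := by
    have := hmem v
    rw [hw] at this
    simpa using this
  choose idx hidx hwidx using hsurj
  have hPidx (k : ℕ) : P (idx (w k)) = P k := by
    rw [← hPper.map_mod_nat k, ← hinj _ _ (hwidx (w k)), Nat.mod_eq_of_lt (hidx _)]
  refine ⟨fun u v => P (idx v) / P (idx u), fun c hc => cycleProd_div (P ∘ idx) c ?_, ?_⟩
  · have := hc.1
    omega
  rintro ⟨u, v⟩ huv
  obtain ⟨j, d, hd0, hd, rfl, rfl⟩ :
      ∃ j d, 0 < d ∧ d < m + 1 ∧ w (j + d) = u ∧ w j = v := by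
    have hne : idx u ≠ idx v := fun h => hE' _ huv (by rw [← hwidx u, h, hwidx])
    have hu := hidx u
    have hv := hidx v
    rcases lt_or_gt_of_ne hne with h | h
    · refine ⟨idx v, idx u + (m + 1) - idx v, by omega, by omega, ?_, hwidx v⟩
      rw [Nat.add_sub_cancel' (by omega), hper, hwidx]
    · refine ⟨idx v, idx u - idx v, by omega, by omega, ?_, hwidx v⟩
      rw [Nat.add_sub_cancel' h.le, hwidx]
  have hcyc : IsCycle ((List.range (d + 1)).map fun k => w (j + k)) := by
    refine ⟨by simp; omega, List.Nodup.map_on ?_ List.nodup_range⟩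
    intro a ha b hb hab
    rw [List.mem_range] at ha hb
    have h : a ≡ b [MOD m + 1] := Nat.ModEq.add_left_cancel' j (hinj _ _ hab)
    exact h.eq_of_lt_of_lt (by omega) (by omega)
  have h1 := hφ' _ hcyc (by
    rw [cycleEdges_map_range]
    intro q hq
    rcases List.mem_append.1 hq with h | h
    · obtain ⟨k, -, rfl⟩ := List.mem_map.1 h
      exact hstep (j + k)
    · rw [List.mem_singleton.1 h]
      exact huv)
  rw [cycleProd_map_range] at h1
  have h2 : P (j + d) = P j * ∏ k ∈ Finset.range d, φ' (w (j + k)) (w (j + (k + 1))) :=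
    Finset.prod_range_add _ _ _
  simp only [hPidx]
  rw [h2, div_mul_cancel_left, inv_eq_iff_mul_eq_one]
  exact h1
end

section
/- Assume every cyclic subset of 𝔻 is almost simple, and let 𝔻' ⊆ 𝔻 be the subset of those elements of 𝔻 that are contained in some cyclic subset of 𝔻. Take D_i ∈ 𝔻' and D_j ∈ 𝔻 ∖ 𝔻', and set D̂ = [D_i, D_j]. Then either D̂ = 0, or D̂ is a root derivation and D̂ is not contained in any cyclic subset of 𝔻 ∪ {D̂}. -/
open scoped BigOperators

/-- `K₀(M)`: the fraction field of the group algebra `K₀[M]` of the lattice `M`. -/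
abbrev RatFunFld (K₀ : Type*) [Field K₀] (M : Type*) [AddCommGroup M] : Type _ :=
  FractionRing (AddMonoidAlgebra K₀ M)

/-- The monomial `χ^u` in `K₀(M)`, `u ∈ M`. -/
noncomputable def chi (K₀ : Type*) [Field K₀] {M : Type*} [AddCommGroup M] (u : M) :
    RatFunFld K₀ M :=
  algebraMap (AddMonoidAlgebra K₀ M) (RatFunFld K₀ M) (AddMonoidAlgebra.of' K₀ M u)

/-- A vector `ρ` of the dual lattice `N = Hom(M, ℤ)` is primitive. -/
def IsPrimitive {M : Type*} [AddCommGroup M] (ρ : M →+ ℤ) : Prop :=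
  ∀ (k : ℤ) (σ : M →+ ℤ), k • σ = ρ → IsUnit k

/-- `e ∈ M` is a Demazure root of the set of rays `rays = Σ(1) ⊆ N` associated with the
ray `ρ`: `⟨ρ, e⟩ = -1` and `⟨ρ', e⟩ ≥ 0` for all other rays `ρ'`. -/
def IsDemazureRoot {M : Type*} [AddCommGroup M] (rays : Finset (M →+ ℤ)) (e : M)
    (ρ : M →+ ℤ) : Prop :=
  ρ ∈ rays ∧ ρ e = -1 ∧ ∀ ρ' ∈ rays, ρ' ≠ ρ → 0 ≤ ρ' e

/-- `D` is the root derivation `D_{φ,ρ,e}`: the `K₀`-derivation of `K₀(M)` satisfying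
`D(χ^u) = φ·⟨ρ,u⟩·χ^{u+e}` for all `u ∈ M`. -/
def IsRootDerivation (K₀ : Type*) [Field K₀] {M : Type*} [AddCommGroup M]
    (D : Derivation K₀ (RatFunFld K₀ M) (RatFunFld K₀ M))
    (φ : K₀) (ρ : M →+ ℤ) (e : M) : Prop :=
  ∀ u : M, D (chi K₀ u) =
    algebraMap K₀ (RatFunFld K₀ M) φ * (ρ u : RatFunFld K₀ M) * chi K₀ (u + e)

/-- The sub-collection of root-derivation data `{(ρ_i, e_i)}` indexed by the list `l`
(a subset of the index set, listed in its cyclic order) is a cyclic set: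
`⟨ρ_{i+1}, e_i⟩ > 0` cyclically along `l`. -/
def IsCyclicList {M : Type*} [AddCommGroup M] {m : ℕ}
    (p : Fin m → (M →+ ℤ)) (e : Fin m → M) (l : List (Fin m)) : Prop :=
  l ≠ [] ∧ l.Nodup ∧ ∀ q ∈ l.zip (l.rotate 1), 0 < (p q.2) (e q.1)

/-- The sub-collection indexed by the list `l` (in its cyclic order) is almost simple:
for every `i` in the cycle, `⟨ρ_i, e_i⟩ = -1`, `⟨ρ_{i+1}, e_i⟩ = 1`, and `⟨ρ, e_i⟩ = 0`
for all rays `ρ` other than `ρ_i, ρ_{i+1}`. -/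
def IsAlmostSimpleList {M : Type*} [AddCommGroup M] (rays : Finset (M →+ ℤ)) {m : ℕ}
    (p : Fin m → (M →+ ℤ)) (e : Fin m → M) (l : List (Fin m)) : Prop :=
  l ≠ [] ∧ l.Nodup ∧ ∀ q ∈ l.zip (l.rotate 1),
    (p q.1) (e q.1) = -1 ∧ (p q.2) (e q.1) = 1 ∧
    ∀ ρ' ∈ rays, ρ' ≠ p q.1 → ρ' ≠ p q.2 → ρ' (e q.1) = 0

/-- The sub-collection indexed by `l` is simple: almost simple and the product of its
functions `φ_i` lies in (the image of) `𝕂`. -/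
def IsSimpleList (𝕂 : Type*) [Field 𝕂] {K₀ : Type*} [Field K₀] [Algebra 𝕂 K₀]
    {M : Type*} [AddCommGroup M] (rays : Finset (M →+ ℤ)) {m : ℕ}
    (φ : Fin m → K₀) (p : Fin m → (M →+ ℤ)) (e : Fin m → M) (l : List (Fin m)) : Prop :=
  IsAlmostSimpleList rays p e l ∧ ∃ c : 𝕂, algebraMap 𝕂 K₀ c = (l.map φ).prod

section Cycles

variable {α : Type*}

theorem List.forall_mem_zip_append_singleton_iff_isChain (R : α → α → Prop) (a b : α)
    (t : List α) :
    (∀ q ∈ (a :: t).zip (t ++ [b]), R q.1 q.2) ↔ (a :: (t ++ [b])).IsChain R := by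
  induction t generalizing a with
  | nil => simp
  | cons c t ih =>
    rw [List.cons_append, List.zip_cons_cons, List.forall_mem_cons, ih c,
      List.isChain_cons_cons]

theorem List.forall_mem_zip_rotate_one_iff_chain (R : α → α → Prop) (l : List α) :
    (∀ q ∈ l.zip (l.rotate 1), R q.1 q.2) ↔ Cycle.Chain R (l : Cycle α) := by
  cases l with
  | nil => simp
  | cons a t =>
    rw [Cycle.chain_coe_cons, ← List.forall_mem_zip_append_singleton_iff_isChain]
    simp

/-- A path can be shortened to one without repeated vertices. -/
theorem Relation.ReflTransGen.exists_nodup_isChain {R : α → α → Prop} {x y : α}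
    (h : Relation.ReflTransGen R x y) :
    ∃ l : List α, (x :: l).Nodup ∧ (x :: l).IsChain R ∧
      (x :: l).getLast (List.cons_ne_nil x l) = y := by
  induction h using Relation.ReflTransGen.head_induction_on with
  | refl => exact ⟨[], by simp, by simp, rfl⟩
  | @head x z hxz _ ih =>
    obtain ⟨l, hnd, hch, hlast⟩ := ih
    by_cases hx : x ∈ z :: l
    · obtain ⟨s, t, hst⟩ := List.append_of_mem hx
      refine ⟨t, ?_, ?_, ?_⟩
      · rw [hst] at hnd
        exact hnd.of_append_right
      · rw [hst] at hch
        exact hch.right_of_append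
      · rw [← hlast]
        simp [hst]
    · exact ⟨z :: l, List.nodup_cons.2 ⟨hx, hnd⟩, List.isChain_cons_cons.2 ⟨hxz, hch⟩, by
        simpa using hlast⟩

/-- A closed walk through `x` contains a cycle through `x` without repeated vertices. -/
theorem Relation.TransGen.exists_nodup_chain {R : α → α → Prop} {x : α}
    (h : Relation.TransGen R x x) :
    ∃ l : List α, l.Nodup ∧ Cycle.Chain R (l : Cycle α) ∧ x ∈ l := by
  obtain ⟨k, hxk, hkx⟩ := Relation.TransGen.tail'_iff.1 h
  obtain ⟨l, hnd, hch, hlast⟩ := hxk.exists_nodup_isChain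
  refine ⟨x :: l, hnd, ?_, by simp⟩
  rw [Cycle.chain_coe_cons, ← List.cons_append, List.isChain_append]
  refine ⟨hch, by simp, ?_⟩
  intro a ha b hb
  rw [List.getLast?_eq_getLast_of_ne_nil (List.cons_ne_nil x l), hlast] at ha
  simp only [Option.mem_def, Option.some.injEq, List.head?_cons] at ha hb
  exact ha ▸ hb ▸ hkx

/-- A walk in `Fin (m + 1)` ending at the last vertex, which it does not visit before, comes from
a walk in `Fin m`. -/
theorem Fin.exists_reflTransGen_of_isChain_last {m : ℕ}
    (R : Fin (m + 1) → Fin (m + 1) → Prop) (x : Fin m) (w : List (Fin (m + 1)))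
    (hw : Fin.last m ∉ w) (h : (x.castSucc :: (w ++ [Fin.last m])).IsChain R) :
    ∃ k : Fin m, Relation.ReflTransGen (fun a b : Fin m => R a.castSucc b.castSucc) x k ∧
      R k.castSucc (Fin.last m) := by
  induction w generalizing x with
  | nil => exact ⟨x, .refl, by simpa using h⟩
  | cons c w ih =>
    rw [List.mem_cons, not_or] at hw
    obtain ⟨c, rfl⟩ := Fin.exists_castSucc_eq.2 (Ne.symm hw.1)
    rw [List.cons_append, List.isChain_cons_cons] at h
    obtain ⟨k, hck, hk⟩ := ih c hw.2 h.2
    exact ⟨k, .head h.1 hck, hk⟩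

/-- A cycle through the last vertex of `Fin (m + 1)` leaves it, follows a walk in `Fin m`, and
returns. -/
theorem Fin.exists_reflTransGen_of_chain_last {m : ℕ}
    (R : Fin (m + 1) → Fin (m + 1) → Prop) (hR : ¬ R (Fin.last m) (Fin.last m))
    (l : List (Fin (m + 1))) (hnd : l.Nodup) (hl : Cycle.Chain R (l : Cycle (Fin (m + 1))))
    (hmem : Fin.last m ∈ l) :
    ∃ x k : Fin m, R (Fin.last m) x.castSucc ∧
      Relation.ReflTransGen (fun a b : Fin m => R a.castSucc b.castSucc) x k ∧
      R k.castSucc (Fin.last m) := by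
  obtain ⟨s, t, rfl⟩ := List.append_of_mem hmem
  have hrot : (s ++ Fin.last m :: t) ~r (Fin.last m :: (t ++ s)) := List.isRotated_append
  rw [Cycle.coe_eq_coe.2 hrot, Cycle.chain_coe_cons] at hl
  have hnd' := List.nodup_cons.1 (hrot.nodup_iff.1 hnd)
  generalize t ++ s = w at hl hnd'
  cases w with
  | nil => exact absurd (by simpa using hl) hR
  | cons x w =>
    rw [List.mem_cons, not_or] at hnd'
    obtain ⟨x, rfl⟩ := Fin.exists_castSucc_eq.2 (Ne.symm hnd'.1.1)
    rw [List.cons_append, List.isChain_cons_cons] at hl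
    obtain ⟨k, hxk, hk⟩ := Fin.exists_reflTransGen_of_isChain_last R x w hnd'.1.2 hl.2
    exact ⟨x, k, hl.1, hxk, hk⟩

theorem List.exists_mem_zip_rotate_one {l : List α} {a : α} (ha : a ∈ l) :
    ∃ b, (a, b) ∈ l.zip (l.rotate 1) := by
  rw [← List.map_fst_zip (l₁ := l) (l₂ := l.rotate 1) (by simp)] at ha
  obtain ⟨⟨_, b⟩, hq, rfl⟩ := List.mem_map.1 ha
  exact ⟨b, hq⟩

end Cycles

section RootData

variable {M : Type*} [AddCommGroup M] {m : ℕ}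

theorem isCyclicList_iff_chain (p : Fin m → (M →+ ℤ)) (e : Fin m → M) (l : List (Fin m)) :
    IsCyclicList p e l ↔ l ≠ [] ∧ l.Nodup ∧
      Cycle.Chain (fun a b => 0 < p b (e a)) (l : Cycle (Fin m)) := by
  rw [IsCyclicList, ← List.forall_mem_zip_rotate_one_iff_chain]

theorem exists_isCyclicList_of_transGen {p : Fin m → (M →+ ℤ)} {e : Fin m → M} {j : Fin m}
    (h : Relation.TransGen (fun a b => 0 < p b (e a)) j j) :
    ∃ l : List (Fin m), IsCyclicList p e l ∧ j ∈ l := by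
  obtain ⟨l, hnd, hch, hj⟩ := h.exists_nodup_chain
  exact ⟨l, (isCyclicList_iff_chain p e l).2 ⟨List.ne_nil_of_mem hj, hnd, hch⟩, hj⟩

theorem exists_reflTransGen_of_isCyclicList_snoc {p : Fin m → (M →+ ℤ)} {e : Fin m → M}
    {ρ : M →+ ℤ} {v : M} (hv : ρ v = -1) {l : List (Fin (m + 1))}
    (hl : IsCyclicList (Fin.snoc p ρ) (Fin.snoc e v) l) (hmem : Fin.last m ∈ l) :
    ∃ x k : Fin m, 0 < p x v ∧
      Relation.ReflTransGen (fun a b => 0 < p b (e a)) x k ∧ 0 < ρ (e k) := by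
  obtain ⟨-, hnd, hch⟩ := (isCyclicList_iff_chain _ _ l).1 hl
  obtain ⟨x, k, hx, hxk, hk⟩ :=
    Fin.exists_reflTransGen_of_chain_last _ (by simp [hv]) l hnd hch hmem
  simp only [Fin.snoc_last, Fin.snoc_castSucc] at hx hxk hk
  exact ⟨x, k, hx, hxk, hk⟩

theorem IsDemazureRoot.add {rays : Finset (M →+ ℤ)} {e e' : M} {ρ ρ' : M →+ ℤ}
    (h : IsDemazureRoot rays e ρ) (h' : IsDemazureRoot rays e' ρ') (hzero : ρ e' = 0)
    (hpos : 0 < ρ' e) : IsDemazureRoot rays (e + e') ρ := by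
  refine ⟨h.1, by rw [map_add, h.2.1, hzero, add_zero], fun σ hσ hne => ?_⟩
  rw [map_add]
  by_cases hσ' : σ = ρ'
  · rw [hσ', h'.2.1]
    omega
  · exact add_nonneg (h.2.2 σ hσ hne) (h'.2.2 σ hσ hσ')

end RootData

section Derivations

variable {K₀ : Type*} [Field K₀] {M : Type*} [AddCommGroup M]

theorem derivation_eq_zero_of_chi [IsDomain (AddMonoidAlgebra K₀ M)]
    (D : Derivation K₀ (RatFunFld K₀ M) (RatFunFld K₀ M)) (h : ∀ u : M, D (chi K₀ u) = 0) :
    D = 0 := by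
  have hpoly : ∀ x : AddMonoidAlgebra K₀ M,
      D (algebraMap (AddMonoidAlgebra K₀ M) (RatFunFld K₀ M) x) = 0 := by
    intro x
    induction x using AddMonoidAlgebra.induction_on with
    | of u => exact h u
    | add x y hx hy => rw [map_add, map_add, hx, hy, add_zero]
    | smul c x hx => rw [Algebra.algebraMap_eq_smul_one, smul_assoc, ← Algebra.algebraMap_eq_smul_one,
      D.map_smul, hx, smul_zero]
  ext x
  obtain ⟨a, b, -, rfl⟩ := IsFractionRing.div_surjective (A := AddMonoidAlgebra K₀ M) x
  rw [Derivation.leibniz_div, hpoly, hpoly]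
  simp

theorem IsRootDerivation.apply_mul_chi {D : Derivation K₀ (RatFunFld K₀ M) (RatFunFld K₀ M)}
    {φ : K₀} {ρ : M →+ ℤ} {e : M} (hD : IsRootDerivation K₀ D φ ρ e) (c : K₀) (n : ℤ) (u : M) :
    D (algebraMap K₀ (RatFunFld K₀ M) c * (n : RatFunFld K₀ M) * chi K₀ u) =
      algebraMap K₀ (RatFunFld K₀ M) (c * φ) * ((n * ρ u : ℤ) : RatFunFld K₀ M) *
        chi K₀ (u + e) := by
  rw [mul_assoc, ← Algebra.smul_def, ← zsmul_eq_mul, D.map_smul, map_zsmul, hD u, zsmul_eq_mul,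
    Algebra.smul_def, map_mul]
  push_cast
  ring

theorem IsRootDerivation.commutator_chi
    {D D' : Derivation K₀ (RatFunFld K₀ M) (RatFunFld K₀ M)} {φ φ' : K₀} {ρ ρ' : M →+ ℤ} {e e' : M}
    (hD : IsRootDerivation K₀ D φ ρ e) (hD' : IsRootDerivation K₀ D' φ' ρ' e') (u : M) :
    ⁅D, D'⁆ (chi K₀ u) = algebraMap K₀ (RatFunFld K₀ M) (φ * φ') *
      ((ρ e' * ρ' u - ρ' e * ρ u : ℤ) : RatFunFld K₀ M) * chi K₀ (u + (e + e')) := by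
  rw [Derivation.commutator_apply, hD' u, hD u, hD.apply_mul_chi, hD'.apply_mul_chi,
    add_assoc u e' e, add_comm e' e, add_assoc u e e', mul_comm φ' φ, map_add, map_add]
  push_cast
  ring

end Derivations

/-- Lemma `lemcomp`. Assume every cyclic subset of
`𝔻 = {D_{φ_i,ρ_i,e_i}}_{i=1}^m` is almost simple, and let `𝔻'` be the set of elements of
`𝔻` contained in some cyclic subset. For `D_i ∈ 𝔻'` and `D_j ∈ 𝔻 ∖ 𝔻'`, the commutator
`D̂ = [D_i, D_j]` is either zero, or a root derivation which is not contained in any cyclic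
subset of `𝔻 ∪ {D̂}`. -/
theorem commutator_with_noncyclic_element
    (𝕂 : Type*) [Field 𝕂] [IsAlgClosed 𝕂] [CharZero 𝕂]
    (K₀ : Type*) [Field K₀] [Algebra 𝕂 K₀]
    (M : Type*) [AddCommGroup M] [Module.Free ℤ M] [Module.Finite ℤ M]
    [IsDomain (AddMonoidAlgebra K₀ M)]
    (rays : Finset (M →+ ℤ)) (hprim : ∀ ρ ∈ rays, IsPrimitive ρ)
    {m : ℕ} (hm : 2 ≤ m)
    (D : Fin m → Derivation K₀ (RatFunFld K₀ M) (RatFunFld K₀ M))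
    (φ : Fin m → K₀) (p : Fin m → (M →+ ℤ)) (e : Fin m → M)
    (hroot : ∀ i, IsDemazureRoot rays (e i) (p i))
    (hD : ∀ i, IsRootDerivation K₀ (D i) (φ i) (p i) (e i))
    (hφ : ∀ i, φ i ≠ 0)
    (hnp : ∀ i j : Fin m, i ≠ j → ∀ c : K₀,
      ⇑(D j) ≠ fun x => algebraMap K₀ (RatFunFld K₀ M) c * D i x)
    (hcyc : ∀ l : List (Fin m), IsCyclicList p e l → IsAlmostSimpleList rays p e l)
    (i j : Fin m)
    (hi : ∃ l : List (Fin m), IsCyclicList p e l ∧ i ∈ l)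
    (hj : ¬ ∃ l : List (Fin m), IsCyclicList p e l ∧ j ∈ l) :
    ⁅D i, D j⁆ = 0 ∨
      ∃ (ψ : K₀) (ρhat : M →+ ℤ) (ehat : M),
        IsDemazureRoot rays ehat ρhat ∧
        IsRootDerivation K₀ ⁅D i, D j⁆ ψ ρhat ehat ∧
        ∀ l : List (Fin (m + 1)),
          IsCyclicList (Fin.snoc p ρhat) (Fin.snoc e ehat) l → Fin.last m ∉ l := by
  have hab : ∀ u : M, ⁅D i, D j⁆ (chi K₀ u) = _ := (hD i).commutator_chi (hD j)
  have hj' : ¬ Relation.TransGen (fun a b => 0 < p b (e a)) j j :=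
    fun h => hj (exists_isCyclicList_of_transGen h)
  by_cases hp : p i = p j
  · left
    refine derivation_eq_zero_of_chi _ fun u => ?_
    rw [hab u, ← hp, (hroot i).2.1, hp, (hroot j).2.1, sub_self]
    simp
  have ha : 0 ≤ p i (e j) := (hroot j).2.2 _ (hroot i).1 hp
  have hb : 0 ≤ p j (e i) := (hroot i).2.2 _ (hroot j).1 (Ne.symm hp)
  rcases ha.eq_or_lt' with ha0 | hapos
  · rcases hb.eq_or_lt' with hb0 | hbpos
    · left
      refine derivation_eq_zero_of_chi _ fun u => ?_
      rw [hab u, ha0, hb0]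
      simp
    · right
      refine ⟨-(φ i * φ j * (p j (e i) : ℤ)), p i, e i + e j,
        (hroot i).add (hroot j) ha0 hbpos, fun u => ?_, fun l hl hmem => ?_⟩
      · rw [hab u, ha0]
        simp only [map_mul, map_neg, map_intCast]
        push_cast
        ring
      obtain ⟨li, hli, hili⟩ := hi
      obtain ⟨n, hn⟩ := List.exists_mem_zip_rotate_one hili
      obtain ⟨-, hn1, hn0⟩ := (hcyc li hli).2.2 _ hn
      have hnext : ∀ x, 0 < p x (e i) → p x = p n := by
        intro x hx
        by_contra hne
        have hxi : p x ≠ p i := by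
          intro h
          rw [h, (hroot i).2.1] at hx
          omega
        exact hx.ne' (hn0 _ (hroot x).1 hxi hne)
      have hbase : (p i) (e i + e j) = -1 := by rw [map_add, (hroot i).2.1, ha0, add_zero]
      obtain ⟨x, k, hx, hxk, hk⟩ := exists_reflTransGen_of_isCyclicList_snoc hbase hl hmem
      rw [map_add] at hx
      by_cases hjx : 0 < p x (e j)
      · exact hj' (.head' hjx ((hxk.tail hk).tail hbpos))
      · have hxj : p x = p j := (hnext x (by omega)).trans (hnext j hbpos).symm
        rw [hxj, (hroot j).2.1, hnext j hbpos, hn1] at hx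
        omega
  · rcases hb.eq_or_lt' with hb0 | hbpos
    · right
      have hr := (hroot j).add (hroot i) hb0 hapos
      rw [add_comm] at hr
      refine ⟨φ i * φ j * (p i (e j) : ℤ), p j, e i + e j, hr, fun u => ?_, fun l hl hmem => ?_⟩
      · rw [hab u, hb0]
        simp only [map_mul, map_intCast]
        push_cast
        ring
      obtain ⟨x, k, hx, hxk, hk⟩ := exists_reflTransGen_of_isCyclicList_snoc hr.2.1 hl hmem
      rw [map_add] at hx
      refine hj' ?_
      by_cases hjx : 0 < p x (e j)
      · exact .head' hjx (hxk.tail hk)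
      · have hix : 0 < p x (e i) := by omega
        exact .head' hapos (.head hix (hxk.tail hk))
    · exact absurd (.head hapos (.single hbpos)) hj'
end

section
/- Suppose {D₁, D₂} is a cyclic set of root derivations, so a := ⟨ρ₂, e₁⟩ > 0 and ⟨ρ₁, e₂⟩ > 0, and let D₂' := [⋯[[D₁, D₂], D₂]⋯, D₂] be the iterated commutator in which D₂ is bracketed a + 1 times. Then D₂' is a nonzero derivation of K₀(M). -/
open scoped BigOperators

theorem chi_ne_zero (K₀ : Type*) [Field K₀] {M : Type*} [AddCommGroup M]
    (u : M) : chi K₀ u ≠ 0 := by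
  intro h
  have h' := IsFractionRing.injective (AddMonoidAlgebra K₀ M) (RatFunFld K₀ M)
    (h.trans (map_zero _).symm)
  exact one_ne_zero (Finsupp.single_eq_zero.mp (congrArg AddMonoidAlgebra.coeff h'))

/-- The commutator of two homogeneous derivations is homogeneous. -/
theorem IsRootDerivation.commutator {K₀ : Type*} [Field K₀] {M : Type*} [AddCommGroup M]
    {X Y : Derivation K₀ (RatFunFld K₀ M) (RatFunFld K₀ M)} {c d : K₀} {p q : M →+ ℤ} {e f : M}
    (hX : IsRootDerivation K₀ X c p e) (hY : IsRootDerivation K₀ Y d q f) :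
    IsRootDerivation K₀ ⁅X, Y⁆ (c * d) (p f • q - q e • p) (e + f) := by
  have key (D : Derivation K₀ (RatFunFld K₀ M) (RatFunFld K₀ M)) (b : K₀) (n : ℤ)
      (x : RatFunFld K₀ M) : D (algebraMap K₀ (RatFunFld K₀ M) b * (n : RatFunFld K₀ M) * x) =
        algebraMap K₀ (RatFunFld K₀ M) b * (n : RatFunFld K₀ M) * D x := by
    rw [← map_intCast (algebraMap K₀ (RatFunFld K₀ M)) n, ← map_mul, ← Algebra.smul_def,
      D.map_smul, Algebra.smul_def]
  intro u
  rw [Derivation.commutator_apply, hY u, hX u, key, key, hX, hY,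
    show u + f + e = u + (e + f) by abel, show u + e + f = u + (e + f) by abel]
  simp only [map_add, AddMonoidHom.sub_apply, AddMonoidHom.smul_apply, smul_eq_mul, map_mul]
  push_cast
  ring

/-- The `n`-fold commutator with `D₂` has linear part `± (A ρ₁ - C ρ₂)` with
`A, C` nonnegative, and `C` positive once `n` is. -/
theorem exists_isRootDerivation_iterate_commutator {K₀ : Type*} [Field K₀] {M : Type*}
    [AddCommGroup M] {D₁ D₂ : Derivation K₀ (RatFunFld K₀ M) (RatFunFld K₀ M)}
    {φ₁ φ₂ : K₀} {ρ₁ ρ₂ : M →+ ℤ} {e₁ e₂ : M}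
    (hD₁ : IsRootDerivation K₀ D₁ φ₁ ρ₁ e₁) (hD₂ : IsRootDerivation K₀ D₂ φ₂ ρ₂ e₂)
    (h₂ : ρ₂ e₂ = -1) (hb : 0 < ρ₁ e₂) (n : ℕ) (hn : (n : ℤ) ≤ ρ₂ e₁ + 1) :
    ∃ A C : ℤ, 0 ≤ A ∧ ((n : ℤ) ≤ ρ₂ e₁ → 0 < A) ∧ 0 ≤ C ∧ (0 < n → 0 < C) ∧
      IsRootDerivation K₀ ((fun X => ⁅X, D₂⁆)^[n] D₁) (φ₁ * φ₂ ^ n)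
        ((-1 : ℤ) ^ n • (A • ρ₁ - C • ρ₂)) (e₁ + n • e₂) := by
  induction n with
  | zero => exact ⟨1, 0, by simp, by simp, le_rfl, by simp, by simpa using hD₁⟩
  | succ n ih =>
    push_cast at hn
    obtain ⟨A, C, hA, hA', hC, -, h⟩ := ih (by linarith)
    have hApos : 0 < A := hA' (by linarith)
    have hC' : 0 < (ρ₂ e₁ - n + 1) * C + ρ₁ e₂ * A :=
      add_pos_of_nonneg_of_pos (mul_nonneg (by linarith) hC) (mul_pos hb hApos)
    refine ⟨(ρ₂ e₁ - n) * A, (ρ₂ e₁ - n + 1) * C + ρ₁ e₂ * A,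
      mul_nonneg (by linarith) hA, fun hlt => mul_pos ?_ hApos, hC'.le, fun _ => hC', ?_⟩
    · push_cast at hlt
      linarith
    · rw [Function.iterate_succ_apply']
      convert h.commutator hD₂ using 1
      · ring
      · ext u
        simp only [AddMonoidHom.sub_apply, AddMonoidHom.smul_apply, smul_eq_mul, map_add,
          map_nsmul, nsmul_eq_mul, h₂]
        ring
      · rw [succ_nsmul, add_assoc]

/-- Claim 1 in the proof of Theorem `findim`. If `{D₁, D₂}` is a cyclic
pair of root derivations, `a := ⟨ρ₂, e₁⟩ > 0` and `⟨ρ₁, e₂⟩ > 0`, then the iterated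
commutator `D₂' = [⋯[[D₁, D₂], D₂]⋯, D₂]` (with `D₂` bracketed `a + 1` times) is a nonzero
derivation of `K₀(M)`. -/
theorem iterated_commutator_ne_zero
    (𝕂 : Type*) [Field 𝕂] [IsAlgClosed 𝕂] [CharZero 𝕂]
    (K₀ : Type*) [Field K₀] [Algebra 𝕂 K₀]
    (M : Type*) [AddCommGroup M] [Module.Free ℤ M] [Module.Finite ℤ M]
    [IsDomain (AddMonoidAlgebra K₀ M)]
    (rays : Finset (M →+ ℤ)) (hprim : ∀ ρ ∈ rays, IsPrimitive ρ)
    (D₁ D₂ : Derivation K₀ (RatFunFld K₀ M) (RatFunFld K₀ M))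
    (φ₁ φ₂ : K₀) (ρ₁ ρ₂ : M →+ ℤ) (e₁ e₂ : M)
    (hroot₁ : IsDemazureRoot rays e₁ ρ₁) (hroot₂ : IsDemazureRoot rays e₂ ρ₂)
    (hD₁ : IsRootDerivation K₀ D₁ φ₁ ρ₁ e₁) (hD₂ : IsRootDerivation K₀ D₂ φ₂ ρ₂ e₂)
    (hφ₁ : φ₁ ≠ 0) (hφ₂ : φ₂ ≠ 0)
    (ha : 0 < ρ₂ e₁) (hb : 0 < ρ₁ e₂) :
    (fun X => ⁅X, D₂⁆)^[(ρ₂ e₁).toNat + 1] D₁ ≠ 0 := by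
  have : CharZero K₀ := charZero_of_injective_algebraMap (algebraMap 𝕂 K₀).injective
  have : CharZero (RatFunFld K₀ M) :=
    charZero_of_injective_algebraMap (algebraMap K₀ (RatFunFld K₀ M)).injective
  obtain ⟨A, C, hA, -, -, hC, h⟩ := exists_isRootDerivation_iterate_commutator hD₁ hD₂
    hroot₂.2.1 hb ((ρ₂ e₁).toNat + 1) (by push_cast; rw [Int.toNat_of_nonneg ha.le])
  have hpos : 0 < A * ρ₁ e₂ + C :=
    add_pos_of_nonneg_of_pos (mul_nonneg hA hb.le) (hC (Nat.succ_pos _))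
  intro h0
  have he := h e₂
  rw [h0, Derivation.zero_apply] at he
  refine mul_ne_zero (mul_ne_zero ?_ ?_) (chi_ne_zero K₀ _) he.symm
  · exact (map_ne_zero _).mpr (mul_ne_zero hφ₁ (pow_ne_zero _ hφ₂))
  · refine Int.cast_ne_zero.mpr ?_
    simp only [AddMonoidHom.sub_apply, AddMonoidHom.smul_apply, smul_eq_mul, hroot₂.2.1]
    exact mul_ne_zero (pow_ne_zero _ (by norm_num)) (by linarith)
end

section
/- Suppose {D₁, D₂} is a cyclic set of root derivations, so a := ⟨ρ₂, e₁⟩ > 0 and ⟨ρ₁, e₂⟩ > 0, and let D₂' := [⋯[[D₁, D₂], D₂]⋯, D₂] be the iterated commutator in which D₂ is bracketed a + 1 times. Then the vector e₁ + (a+1)e₂ is a Demazure root of Σ(1) associated with the ray ρ₂, and D₂' is a root derivation associated with ρ₂: there is a nonzero ψ ∈ K₀ with D₂'(χ^u) = ψ·⟨ρ₂, u⟩·χ^{u + e₁ + (a+1)e₂} for all u ∈ M. -/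
open scoped BigOperators

/-- The commutator of two derivations that shift monomials by `e` and `e'`. -/
theorem commutator_apply_chi {K₀ : Type*} [Field K₀] {M : Type*} [AddCommGroup M]
    {X Y : Derivation K₀ (RatFunFld K₀ M) (RatFunFld K₀ M)} {F G : M → K₀} {e e' : M}
    (hX : ∀ u, X (chi K₀ u) = F u • chi K₀ (u + e))
    (hY : ∀ u, Y (chi K₀ u) = G u • chi K₀ (u + e')) (u : M) :
    ⁅X, Y⁆ (chi K₀ u) = (G u * F (u + e') - F u * G (u + e)) • chi K₀ (u + (e + e')) := by
  rw [Derivation.commutator_apply, hX, hY, Derivation.map_smul, Derivation.map_smul, hX, hY,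
    smul_smul, smul_smul, sub_smul, add_assoc, add_assoc, add_comm e' e]

theorem isRootDerivation_iff_smul {K₀ : Type*} [Field K₀] {M : Type*} [AddCommGroup M]
    {D : Derivation K₀ (RatFunFld K₀ M) (RatFunFld K₀ M)} {φ : K₀} {ρ : M →+ ℤ} {e : M} :
    IsRootDerivation K₀ D φ ρ e ↔
      ∀ u, D (chi K₀ u) = (φ * (ρ u : K₀)) • chi K₀ (u + e) := by
  simp only [IsRootDerivation, Algebra.smul_def, map_mul, map_intCast]

theorem isDemazureRoot_add_zsmul {M : Type*} [AddCommGroup M] {rays : Finset (M →+ ℤ)}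
    {ρ₁ ρ₂ : M →+ ℤ} {e₁ e₂ : M}
    (hroot₁ : IsDemazureRoot rays e₁ ρ₁) (hroot₂ : IsDemazureRoot rays e₂ ρ₂)
    (ha : 0 < ρ₂ e₁) (hb : 0 < ρ₁ e₂) :
    IsDemazureRoot rays (e₁ + (ρ₂ e₁ + 1) • e₂) ρ₂ := by
  obtain ⟨-, h₁, h₁'⟩ := hroot₁
  obtain ⟨hρ₂, h₂, h₂'⟩ := hroot₂
  refine ⟨hρ₂, ?_, fun ρ hρ hne => ?_⟩
  · simp [h₂]
  · rw [map_add, map_zsmul, smul_eq_mul]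
    by_cases h : ρ = ρ₁
    · subst h
      nlinarith
    · have := h₁' ρ hρ h
      have := h₂' ρ hρ hne
      positivity

/-- The `k`-fold bracket of a root derivation with a second one, in closed form. -/
theorem exists_iterate_commutator_apply_chi {K₀ : Type*} [Field K₀] [CharZero K₀]
    {M : Type*} [AddCommGroup M]
    {D₁ D₂ : Derivation K₀ (RatFunFld K₀ M) (RatFunFld K₀ M)}
    {φ₁ φ₂ : K₀} {ρ₁ ρ₂ : M →+ ℤ} {e₁ e₂ : M}
    (hD₁ : IsRootDerivation K₀ D₁ φ₁ ρ₁ e₁) (hD₂ : IsRootDerivation K₀ D₂ φ₂ ρ₂ e₂)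
    (hφ₁ : φ₁ ≠ 0) (hφ₂ : φ₂ ≠ 0) (he₂ : ρ₂ e₂ = -1) {a : ℕ} (ha : ρ₂ e₁ = a)
    {k : ℕ} (hk : k ≤ a + 1) :
    ∃ t : K₀, t ≠ 0 ∧ ∀ u, ((fun X => ⁅X, D₂⁆)^[k] D₁) (chi K₀ u) =
      (t * ((a - k + 1) * (ρ₁ u : K₀) - ρ₁ e₂ * k * (ρ₂ u : K₀))) •
        chi K₀ (u + (e₁ + k • e₂)) := by
  rw [isRootDerivation_iff_smul] at hD₁ hD₂
  induction k with
  | zero =>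
    have ha' : (a : K₀) + 1 ≠ 0 := by exact_mod_cast a.succ_ne_zero
    refine ⟨φ₁ / (a + 1), div_ne_zero hφ₁ ha', fun u => ?_⟩
    simp only [Function.iterate_zero, id_eq, hD₁, zero_smul, add_zero]
    congr 1
    push_cast
    field_simp
    ring
  | succ k ih =>
    obtain ⟨t, ht, h⟩ := ih (by omega)
    have hak : (a : K₀) - k + 1 ≠ 0 := by
      rw [← Nat.cast_sub (by omega : k ≤ a)]
      exact_mod_cast (a - k).succ_ne_zero
    refine ⟨-(a - k + 1) * φ₂ * t, mul_ne_zero (mul_ne_zero (neg_ne_zero.2 hak) hφ₂) ht,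
      fun u => ?_⟩
    rw [Function.iterate_succ_apply', commutator_apply_chi h hD₂, succ_nsmul, add_assoc e₁]
    congr 1
    simp only [map_add, map_nsmul, he₂, ha]
    push_cast
    simp only [nsmul_eq_mul]
    push_cast
    ring

/-- Claim 2 in the proof of Theorem `findim`. If `{D₁, D₂}` is a cyclic
pair of root derivations, `a := ⟨ρ₂, e₁⟩ > 0` and `⟨ρ₁, e₂⟩ > 0`, then `e₁ + (a+1)e₂` is a
Demazure root associated with the ray `ρ₂`, and the iterated commutator
`D₂' = [⋯[[D₁, D₂], D₂]⋯, D₂]` (with `D₂` bracketed `a + 1` times) is a root derivation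
associated with `ρ₂`: `D₂'(χ^u) = ψ·⟨ρ₂,u⟩·χ^{u+e₁+(a+1)e₂}` for some nonzero `ψ ∈ K₀`. -/
theorem iterated_commutator_is_root_derivation
    (𝕂 : Type*) [Field 𝕂] [IsAlgClosed 𝕂] [CharZero 𝕂]
    (K₀ : Type*) [Field K₀] [Algebra 𝕂 K₀]
    (M : Type*) [AddCommGroup M] [Module.Free ℤ M] [Module.Finite ℤ M]
    [IsDomain (AddMonoidAlgebra K₀ M)]
    (rays : Finset (M →+ ℤ)) (hprim : ∀ ρ ∈ rays, IsPrimitive ρ)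
    (D₁ D₂ : Derivation K₀ (RatFunFld K₀ M) (RatFunFld K₀ M))
    (φ₁ φ₂ : K₀) (ρ₁ ρ₂ : M →+ ℤ) (e₁ e₂ : M)
    (hroot₁ : IsDemazureRoot rays e₁ ρ₁) (hroot₂ : IsDemazureRoot rays e₂ ρ₂)
    (hD₁ : IsRootDerivation K₀ D₁ φ₁ ρ₁ e₁) (hD₂ : IsRootDerivation K₀ D₂ φ₂ ρ₂ e₂)
    (hφ₁ : φ₁ ≠ 0) (hφ₂ : φ₂ ≠ 0)
    (ha : 0 < ρ₂ e₁) (hb : 0 < ρ₁ e₂) :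
    IsDemazureRoot rays (e₁ + (ρ₂ e₁ + 1) • e₂) ρ₂ ∧
      ∃ ψ : K₀, ψ ≠ 0 ∧
        IsRootDerivation K₀ ((fun X => ⁅X, D₂⁆)^[(ρ₂ e₁).toNat + 1] D₁)
          ψ ρ₂ (e₁ + (ρ₂ e₁ + 1) • e₂) := by
  refine ⟨isDemazureRoot_add_zsmul hroot₁ hroot₂ ha hb, ?_⟩
  have : CharZero K₀ := charZero_of_injective_algebraMap (algebraMap 𝕂 K₀).injective
  obtain ⟨a, haa⟩ := Int.eq_ofNat_of_zero_le ha.le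
  obtain ⟨t, ht, h⟩ := exists_iterate_commutator_apply_chi hD₁ hD₂ hφ₁ hφ₂ hroot₂.2.1 haa le_rfl
  have hb' : (ρ₁ e₂ : K₀) ≠ 0 := by exact_mod_cast hb.ne'
  have ha' : (a : K₀) + 1 ≠ 0 := by exact_mod_cast a.succ_ne_zero
  refine ⟨-t * ρ₁ e₂ * (a + 1), mul_ne_zero (mul_ne_zero (neg_ne_zero.2 ht) hb') ha', ?_⟩
  rw [isRootDerivation_iff_smul]
  intro u
  have hsmul : (ρ₂ e₁ + 1) • e₂ = (a + 1) • e₂ := by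
    rw [haa, ← natCast_zsmul]
    push_cast
    rfl
  rw [hsmul, haa, Int.toNat_natCast, h]
  congr 1
  push_cast
  ring
end

section
/- Suppose {D₁, D₂} is a cyclic set of root derivations, so a := ⟨ρ₂, e₁⟩ > 0 and ⟨ρ₁, e₂⟩ > 0, and assume moreover that either a ≥ 2, or a = 1 and there exists ρ₃ ∈ Σ(1) with ρ₃ ≠ ρ₁ and ⟨ρ₃, e₂⟩ > 0. Let ρ̄ := Σ_{ρ ∈ Σ(1)} ρ ∈ N. Then ⟨ρ̄, e₁ + (a+1)e₂⟩ > ⟨ρ̄, e₂⟩. -/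
open scoped BigOperators

/-- Claim 3 in the proof of Theorem `findim`. Let `{D₁, D₂}` be a cyclic
pair of root derivations, `a := ⟨ρ₂, e₁⟩ > 0` and `⟨ρ₁, e₂⟩ > 0`, and assume moreover that
either `a ≥ 2`, or `a = 1` and there is a ray `ρ₃ ≠ ρ₁` with `⟨ρ₃, e₂⟩ > 0`. Then for
`ρ̄ := ∑_{ρ ∈ Σ(1)} ρ` one has `⟨ρ̄, e₁ + (a+1)e₂⟩ > ⟨ρ̄, e₂⟩`. -/
theorem sum_of_rays_pairing_increases
    (𝕂 : Type*) [Field 𝕂] [IsAlgClosed 𝕂] [CharZero 𝕂]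
    (K₀ : Type*) [Field K₀] [Algebra 𝕂 K₀]
    (M : Type*) [AddCommGroup M] [Module.Free ℤ M] [Module.Finite ℤ M]
    (rays : Finset (M →+ ℤ)) (hprim : ∀ ρ ∈ rays, IsPrimitive ρ)
    (ρ₁ ρ₂ : M →+ ℤ) (e₁ e₂ : M)
    (hroot₁ : IsDemazureRoot rays e₁ ρ₁) (hroot₂ : IsDemazureRoot rays e₂ ρ₂)
    (ha : 0 < ρ₂ e₁) (hb : 0 < ρ₁ e₂)
    (hextra : 2 ≤ ρ₂ e₁ ∨ (ρ₂ e₁ = 1 ∧ ∃ ρ₃ ∈ rays, ρ₃ ≠ ρ₁ ∧ 0 < ρ₃ e₂)) :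
    (∑ ρ ∈ rays, ρ) e₂ < (∑ ρ ∈ rays, ρ) (e₁ + (ρ₂ e₁ + 1) • e₂) := by
  obtain ⟨hmem₁, hρ₁, hpos₁⟩ := hroot₁
  obtain ⟨-, hρ₂, hpos₂⟩ := hroot₂
  have hnonneg : ∀ ρ ∈ rays, 0 ≤ ρ e₁ + ρ₂ e₁ * ρ e₂ := by
    intro ρ hρ
    by_cases h₁ : ρ = ρ₁
    · subst h₁
      nlinarith
    by_cases h₂ : ρ = ρ₂
    · subst h₂
      simp [hρ₂]
    have := hpos₁ ρ hρ h₁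
    have := hpos₂ ρ hρ h₂
    positivity
  have hpos : ∃ ρ ∈ rays, 0 < ρ e₁ + ρ₂ e₁ * ρ e₂ := by
    rcases hextra with h | ⟨-, ρ₃, hmem₃, hne, h₃⟩
    · exact ⟨ρ₁, hmem₁, by nlinarith⟩
    · have := hpos₁ ρ₃ hmem₃ hne
      exact ⟨ρ₃, hmem₃, by positivity⟩
  have hsum := Finset.sum_pos' hnonneg hpos
  rw [Finset.sum_add_distrib, ← Finset.mul_sum] at hsum
  simp only [map_add, map_zsmul, smul_eq_mul, AddMonoidHom.finsetSum_apply]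
  linarith
end

section
/- Suppose {D₁, D₂} is a cyclic set of root derivations, so a := ⟨ρ₂, e₁⟩ > 0 and ⟨ρ₁, e₂⟩ > 0, and assume moreover that either a ≥ 2, or a = 1 = ⟨ρ₁, e₂⟩ and there exists ρ₃ ∈ Σ(1) with ρ₃ ≠ ρ₁ and ⟨ρ₃, e₂⟩ > 0. Let D₂' := [⋯[[D₁, D₂], D₂]⋯, D₂] be the iterated commutator in which D₂ is bracketed a + 1 times (a root derivation associated with ρ₂ of degree e₁ + (a+1)e₂). Then the set {D₁, D₂'} is again cyclic but not almost simple. -/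
open scoped BigOperators

/-- Claim 4 in the proof of Theorem `findim`. Let `{D₁, D₂}` be a cyclic
pair of root derivations, `a := ⟨ρ₂, e₁⟩ > 0` and `⟨ρ₁, e₂⟩ > 0`, such that either `a ≥ 2`,
or `a = 1 = ⟨ρ₁, e₂⟩` and there is a ray `ρ₃ ≠ ρ₁` with `⟨ρ₃, e₂⟩ > 0`. Let
`D₂' = [⋯[[D₁, D₂], D₂]⋯, D₂]` (with `D₂` bracketed `a + 1` times), a root derivation
associated with `ρ₂` of degree `e₁ + (a+1)e₂`. Then the pair `{D₁, D₂'}` is again cyclic,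
but not almost simple. -/
theorem pair_with_iterated_commutator_cyclic_not_almostSimple
    (𝕂 : Type*) [Field 𝕂] [IsAlgClosed 𝕂] [CharZero 𝕂]
    (K₀ : Type*) [Field K₀] [Algebra 𝕂 K₀]
    (M : Type*) [AddCommGroup M] [Module.Free ℤ M] [Module.Finite ℤ M]
    [IsDomain (AddMonoidAlgebra K₀ M)]
    (rays : Finset (M →+ ℤ)) (hprim : ∀ ρ ∈ rays, IsPrimitive ρ)
    (D₁ D₂ : Derivation K₀ (RatFunFld K₀ M) (RatFunFld K₀ M))
    (φ₁ φ₂ : K₀) (ρ₁ ρ₂ : M →+ ℤ) (e₁ e₂ : M)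
    (hroot₁ : IsDemazureRoot rays e₁ ρ₁) (hroot₂ : IsDemazureRoot rays e₂ ρ₂)
    (hD₁ : IsRootDerivation K₀ D₁ φ₁ ρ₁ e₁) (hD₂ : IsRootDerivation K₀ D₂ φ₂ ρ₂ e₂)
    (hφ₁ : φ₁ ≠ 0) (hφ₂ : φ₂ ≠ 0)
    (ha : 0 < ρ₂ e₁) (hb : 0 < ρ₁ e₂)
    (hextra : 2 ≤ ρ₂ e₁ ∨
      (ρ₂ e₁ = 1 ∧ ρ₁ e₂ = 1 ∧ ∃ ρ₃ ∈ rays, ρ₃ ≠ ρ₁ ∧ 0 < ρ₃ e₂))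
    (ψ : K₀) (hψ : ψ ≠ 0)
    (hD₂' : IsRootDerivation K₀ ((fun X => ⁅X, D₂⁆)^[(ρ₂ e₁).toNat + 1] D₁)
      ψ ρ₂ (e₁ + (ρ₂ e₁ + 1) • e₂)) :
    IsCyclicList ![ρ₁, ρ₂] ![e₁, e₁ + (ρ₂ e₁ + 1) • e₂] [0, 1] ∧
      ¬ IsAlmostSimpleList rays ![ρ₁, ρ₂] ![e₁, e₁ + (ρ₂ e₁ + 1) • e₂] [0, 1] := by
  have h₁ := hroot₁.2.1
  have h₂ := hroot₂.2.1
  refine ⟨⟨by simp, by simp, ?_⟩, ?_⟩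
  · have hpos : 0 < ρ₁ e₁ + (ρ₂ e₁ + 1) * ρ₁ e₂ := by nlinarith
    simpa using ⟨ha, hpos⟩
  · rintro ⟨-, -, h⟩
    have hfirst := (h (0, 1) (by simp)).2.1
    have hsecond := (h (1, 0) (by simp)).2.2
    simp only [Matrix.cons_val_zero, Matrix.cons_val_one] at hfirst hsecond
    rcases hextra with h2 | ⟨-, -, ρ₃, hmem, hne₁, hpos⟩
    · omega
    · have hne₂ : ρ₃ ≠ ρ₂ := by
        rintro rfl
        omega
      have hzero := hsecond ρ₃ hmem hne₂ hne₁
      rw [map_add, map_zsmul, hfirst, smul_eq_mul] at hzero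
      have hnonneg := hroot₁.2.2 ρ₃ hmem hne₁
      omega
end

section
/- Assume the set 𝔻 contains no cyclic subset. Let κ_1,…,κ_r be the pairwise distinct elements of {ρ_1,…,ρ_m}. Then the indexing of κ_1,…,κ_r can be chosen so that, writing α : {1,…,m} → {1,…,r} for the map determined by ρ_j = κ_{α(j)}, the condition ⟨ρ_i, e_j⟩ > 0 implies α(i) > α(j) for all i, j ∈ {1,…,m}. -/
open scoped BigOperators

/-- A self-map of a nonempty finite type has a periodic point. -/
theorem exists_mem_periodicPts {β : Type*} [Finite β] [Nonempty β] (g : β → β) :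
    ∃ x, x ∈ Function.periodicPts g := by
  obtain ⟨x⟩ := ‹Nonempty β›
  obtain ⟨a, b, hab, h⟩ := Finite.exists_ne_map_eq_of_infinite fun n : ℕ => g^[n] x
  wlog hlt : a < b generalizing a b
  · exact this b a hab.symm h.symm (by omega)
  refine ⟨g^[a] x, Function.mk_mem_periodicPts (n := b - a) (by omega) ?_⟩
  rw [Function.IsPeriodicPt, Function.IsFixedPt, ← Function.iterate_add_apply,
    Nat.sub_add_cancel hlt.le]
  exact h.symm

/-- Following a successor map of the relation `0 < ⟨ρ_j, e_i⟩` eventually closes a cycle. -/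
theorem exists_isCyclicList {M : Type*} [AddCommGroup M] {m : ℕ}
    (p : Fin m → (M →+ ℤ)) (e : Fin m → M) {β : Type*} [Finite β] [Nonempty β]
    (c : β → Fin m) (hc : Function.Injective c) (g : β → β)
    (hg : ∀ x, 0 < p (c (g x)) (e (c x))) :
    ∃ l : List (Fin m), IsCyclicList p e l := by
  obtain ⟨x, hx⟩ := exists_mem_periodicPts g
  have hpos := Function.minimalPeriod_pos_of_mem_periodicPts hx
  refine ⟨(List.range (Function.minimalPeriod g x)).map fun n => c (g^[n] x), ?_, ?_, ?_⟩
  · simpa using hpos.ne'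
  · refine List.Nodup.map_on (fun a ha b hb hab => ?_) List.nodup_range
    exact Function.iterate_injOn_Iio_minimalPeriod (List.mem_range.1 ha) (List.mem_range.1 hb)
      (hc hab)
  · intro q hq
    obtain ⟨i, hi, rfl⟩ := List.mem_iff_getElem.1 hq
    simpa [List.getElem_rotate, Function.iterate_mod_minimalPeriod_eq,
      Function.iterate_succ_apply'] using hg (g^[i] x)

/-- An acyclic relation on a finite type is contained in the strict order obtained from some
enumeration of that type. -/
theorem exists_equiv_fin_lt_of_wellFounded {β : Type*} [Finite β] {S : β → β → Prop}
    (hS : WellFounded S) : ∃ (r : ℕ) (f : β ≃ Fin r), ∀ a b, S a b → f a < f b := by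
  classical
  have hT : WellFounded (Relation.TransGen S) := hS.transGen
  have : IsPartialOrder β (Relation.ReflTransGen S) :=
    { refl := fun _ => .refl
      trans := fun _ _ _ => .trans
      antisymm := fun a b hab hba => by
        by_contra hne
        rcases Relation.reflTransGen_iff_eq_or_transGen.1 hab with h | h
        · exact hne h.symm
        · exact hT.irrefl.irrefl a (h.trans_left hba) }
  obtain ⟨s, hs, hle⟩ := extend_partialOrder (Relation.ReflTransGen S)
  have := Fintype.ofFinite β
  let : LinearOrder β :=
    { le := s
      le_refl := hs.refl
      le_trans := hs.trans
      le_antisymm := hs.antisymm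
      le_total := hs.total
      toDecidableLE := Classical.decRel _ }
  let f := (Fintype.orderIsoFinOfCardEq β rfl).symm
  refine ⟨_, f.toEquiv, fun a b hab => f.strictMono ?_⟩
  refine lt_of_le_of_ne (hle _ _ (.single hab)) ?_
  rintro rfl
  exact hS.irrefl.irrefl a hab

/-- Lemma `lemord`. Assume `𝔻 = {D_{φ_i,ρ_i,e_i}}_{i=1}^m` contains no
cyclic subset. Then the pairwise distinct elements `κ_1,…,κ_r` of `{ρ_1,…,ρ_m}` can be
ordered so that, with `α` the map determined by `ρ_j = κ_{α(j)}`, the condition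
`⟨ρ_i, e_j⟩ > 0` implies `α(i) > α(j)`. -/
theorem rays_can_be_ordered
    (𝕂 : Type*) [Field 𝕂] [IsAlgClosed 𝕂] [CharZero 𝕂]
    (K₀ : Type*) [Field K₀] [Algebra 𝕂 K₀]
    (M : Type*) [AddCommGroup M] [Module.Free ℤ M] [Module.Finite ℤ M]
    [IsDomain (AddMonoidAlgebra K₀ M)]
    (rays : Finset (M →+ ℤ)) (hprim : ∀ ρ ∈ rays, IsPrimitive ρ)
    {m : ℕ} (hm : 2 ≤ m)
    (D : Fin m → Derivation K₀ (RatFunFld K₀ M) (RatFunFld K₀ M))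
    (φ : Fin m → K₀) (p : Fin m → (M →+ ℤ)) (e : Fin m → M)
    (hroot : ∀ i, IsDemazureRoot rays (e i) (p i))
    (hD : ∀ i, IsRootDerivation K₀ (D i) (φ i) (p i) (e i))
    (hφ : ∀ i, φ i ≠ 0)
    (hnp : ∀ i j : Fin m, i ≠ j → ∀ c : K₀,
      ⇑(D j) ≠ fun x => algebraMap K₀ (RatFunFld K₀ M) c * D i x)
    (hnocyc : ∀ l : List (Fin m), ¬ IsCyclicList p e l) :
    ∃ (r : ℕ) (κ : Fin r → (M →+ ℤ)) (α : Fin m → Fin r),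
      Function.Injective κ ∧
      (∀ j, p j = κ (α j)) ∧
      (∀ t : Fin r, ∃ j, κ t = p j) ∧
      ∀ i j : Fin m, 0 < (p i) (e j) → α j < α i := by
  let S : Set.range p → Set.range p → Prop := fun a b => ∃ j, p j = a ∧ 0 < b.1 (e j)
  have hS : WellFounded (Function.swap S) := by
    refine WellFounded.wellFounded_iff_has_min.2 fun T hT => ?_
    by_contra! hmin
    have hsucc : ∀ a : T, ∃ b : T, S a b := fun a => by
      obtain ⟨b, hb, hab⟩ := hmin a a.2
      exact ⟨⟨b, hb⟩, hab⟩
    choose g c hpc hpos using hsucc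
    have : Nonempty T := hT.to_subtype
    obtain ⟨l, hl⟩ := exists_isCyclicList p e c
      (fun a b hab => Subtype.ext (Subtype.ext (by rw [← hpc a, hab, hpc b]))) g
      (fun a => by rw [hpc]; exact hpos a)
    exact hnocyc l hl
  obtain ⟨r, f, hf⟩ := exists_equiv_fin_lt_of_wellFounded hS
  refine ⟨r, fun t => (f.symm (Fin.rev t)).1, fun j => Fin.rev (f ⟨p j, j, rfl⟩), ?_, ?_, ?_, ?_⟩
  · exact Subtype.val_injective.comp (f.symm.injective.comp Fin.rev_injective)
  · simp
  · intro t
    obtain ⟨j, hj⟩ := (f.symm (Fin.rev t)).2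
    exact ⟨j, hj.symm⟩
  · intro i j hij
    exact Fin.rev_lt_rev.2 (hf _ _ ⟨j, rfl, hij⟩)
end

section
/- Assume the set 𝔻 contains no cyclic subset, and assume the pairwise distinct rays κ_1,…,κ_r of {ρ_1,…,ρ_m} are ordered so that ⟨ρ_i, e_j⟩ > 0 implies α(i) > α(j), where α : {1,…,m} → {1,…,r} is determined by ρ_j = κ_{α(j)}. Let D_i, D_j, D_s ∈ 𝔻. If ⟨ρ_i, e_j⟩ > 0 and ⟨ρ_s, e_i + e_j⟩ > 0, then α(s) > α(j). In particular, the set 𝔻 ∪ {[D_i, D_j]} contains no cyclic subset. -/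
open scoped BigOperators

/-- A family whose positive pairings strictly increase a rank function has no cyclic list. -/
theorem not_isCyclicList_of_rank {M : Type*} [AddCommGroup M] {m : ℕ} {β : Type*}
    [LinearOrder β] {p : Fin m → (M →+ ℤ)} {e : Fin m → M} (f : Fin m → β)
    (hf : ∀ a b, 0 < (p b) (e a) → f a < f b) (l : List (Fin m)) :
    ¬ IsCyclicList p e l := by
  rintro ⟨hne, -, hcyc⟩
  obtain ⟨a, ha, hmax⟩ := l.toFinset.exists_max_image f (List.toFinset_nonempty_iff l |>.2 hne)
  obtain ⟨k, hk, rfl⟩ := List.mem_iff_getElem.1 (List.mem_toFinset.1 ha)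
  have hk' : k < (l.rotate 1).length := by simpa using hk
  have hmem : (l[k], (l.rotate 1)[k]) ∈ l.zip (l.rotate 1) :=
    List.mem_iff_getElem.2 ⟨k, by simpa using hk, by simp⟩
  have hnext : (l.rotate 1)[k] ∈ l := List.mem_rotate.1 (List.getElem_mem hk')
  exact (hf _ _ (hcyc _ hmem)).not_ge (hmax _ (List.mem_toFinset.2 hnext))

/-- Lemma `lempom`. Assume `𝔻 = {D_{φ_i,ρ_i,e_i}}_{i=1}^m` contains no
cyclic subset and the distinct rays `κ_1,…,κ_r` are ordered so that `⟨ρ_i, e_j⟩ > 0` implies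
`α(i) > α(j)`. If `⟨ρ_i, e_j⟩ > 0` and `⟨ρ_s, e_i + e_j⟩ > 0`, then `α(s) > α(j)`; in
particular, `𝔻 ∪ {[D_i, D_j]}` (whose new element has ray `ρ_j` and degree `e_i + e_j`)
contains no cyclic subset. -/
theorem order_preserved_under_commutator
    (𝕂 : Type*) [Field 𝕂] [IsAlgClosed 𝕂] [CharZero 𝕂]
    (K₀ : Type*) [Field K₀] [Algebra 𝕂 K₀]
    (M : Type*) [AddCommGroup M] [Module.Free ℤ M] [Module.Finite ℤ M]
    [IsDomain (AddMonoidAlgebra K₀ M)]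
    (rays : Finset (M →+ ℤ)) (hprim : ∀ ρ ∈ rays, IsPrimitive ρ)
    {m : ℕ} (hm : 2 ≤ m)
    (D : Fin m → Derivation K₀ (RatFunFld K₀ M) (RatFunFld K₀ M))
    (φ : Fin m → K₀) (p : Fin m → (M →+ ℤ)) (e : Fin m → M)
    (hroot : ∀ i, IsDemazureRoot rays (e i) (p i))
    (hD : ∀ i, IsRootDerivation K₀ (D i) (φ i) (p i) (e i))
    (hφ : ∀ i, φ i ≠ 0)
    (hnp : ∀ i j : Fin m, i ≠ j → ∀ c : K₀,
      ⇑(D j) ≠ fun x => algebraMap K₀ (RatFunFld K₀ M) c * D i x)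
    (hnocyc : ∀ l : List (Fin m), ¬ IsCyclicList p e l)
    {r : ℕ} (κ : Fin r → (M →+ ℤ)) (α : Fin m → Fin r)
    (hκ : Function.Injective κ) (hα : ∀ j, p j = κ (α j))
    (hκsurj : ∀ t : Fin r, ∃ j, κ t = p j)
    (horder : ∀ i j : Fin m, 0 < (p i) (e j) → α j < α i)
    (i j s : Fin m)
    (hij : 0 < (p i) (e j)) (hs : 0 < (p s) (e i + e j)) :
    α j < α s ∧
      ∀ l : List (Fin (m + 1)),
        ¬ IsCyclicList (Fin.snoc p (p j)) (Fin.snoc e (e i + e j)) l := by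
  have key : ∀ s : Fin m, 0 < (p s) (e i + e j) → α j < α s := by
    intro s hs
    rw [map_add] at hs
    by_cases h : 0 < (p s) (e j)
    · exact horder s j h
    · exact (horder i j hij).trans (horder s i (by linarith))
  refine ⟨key s hs, not_isCyclicList_of_rank (Fin.snoc α (α j) : Fin (m + 1) → Fin r) ?_⟩
  intro a b
  induction a using Fin.lastCases with
  | last =>
    induction b using Fin.lastCases with
    | last => simpa using key j
    | cast b => simpa using key b
  | cast a =>
    induction b using Fin.lastCases with
    | last => simpa using horder j a
    | cast b => simpa using horder b a
end

section
/- Consider a finite collection of appropriate vectors in ℤ^r. Then only finitely many linear combinations of these vectors with non-negative integer coefficients are appropriate vectors; that is, the set of appropriate vectors expressible as a non-negative integer linear combination of the given vectors is finite. -/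
open scoped BigOperators

/-- A vector `v ∈ ℤ^r` is appropriate if for some index `i` one has `v_j = 0` for `j < i`,
`v_i = -1`, and `v_j ≥ 0` for `j > i`. -/
def Appropriate {r : ℕ} (v : Fin r → ℤ) : Prop :=
  ∃ i : Fin r, (∀ j : Fin r, j < i → v j = 0) ∧ v i = -1 ∧ ∀ j : Fin r, i < j → 0 ≤ v j

/-- Coefficients of a combination of appropriate vectors all of whose entries are at least `-1`
are bounded, for those vectors whose leading index `p k` is less than `m`. -/
theorem exists_bound_coeff_of_neg_one_le {r n : ℕ} (w : Fin n → (Fin r → ℤ)) (p : Fin n → Fin r)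
    (hp : ∀ k, (∀ j, j < p k → w k j = 0) ∧ w k (p k) = -1 ∧ ∀ j, p k < j → 0 ≤ w k j)
    (m : ℕ) :
    ∃ B : ℕ, ∀ c : Fin n → ℕ, (∀ j, -1 ≤ ∑ i, (c i : ℤ) * w i j) →
      ∀ k, (p k : ℕ) < m → c k ≤ B := by
  induction m with
  | zero => exact ⟨0, fun c _ k hk => absurd hk (Nat.not_lt_zero _)⟩
  | succ m ih =>
    obtain ⟨B, hB⟩ := ih
    by_cases hm : m < r
    · set q : Fin r := ⟨m, hm⟩
      refine ⟨B + 1 + ∑ i, B * (w i q).natAbs, fun c hc k hk => ?_⟩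
      rcases Nat.lt_succ_iff_lt_or_eq.mp hk with hlt | heq
      · have := hB c hc k hlt
        omega
      · have hkq : p k = q := Fin.ext heq
        have hterm : ∀ i ∈ Finset.univ, (c i : ℤ) * w i q ≤
            (B : ℤ) * |w i q| - (if i = k then (c k : ℤ) else 0) := by
          intro i _
          have hBw : 0 ≤ (B : ℤ) * |w i q| := by positivity
          rcases lt_trichotomy (p i) q with h | h | h
          · have hik : i ≠ k := by
              rintro rfl
              exact h.ne hkq
            have hci : (c i : ℤ) ≤ B := by exact_mod_cast hB c hc i h
            rw [if_neg hik, sub_zero, abs_of_nonneg ((hp i).2.2 q h)]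
            exact mul_le_mul_of_nonneg_right hci ((hp i).2.2 q h)
          · have hw : w i q = -1 := h ▸ (hp i).2.1
            split_ifs with hik
            · subst hik
              rw [hw] at hBw ⊢
              linarith
            · rw [hw] at hBw ⊢
              have : (0 : ℤ) ≤ c i := by positivity
              linarith
          · have hik : i ≠ k := by
              rintro rfl
              exact h.ne' hkq
            simp [(hp i).1 q h, hik]
        have hsum := (hc q).trans (Finset.sum_le_sum hterm)
        rw [Finset.sum_sub_distrib, Finset.sum_ite_eq' Finset.univ k,
          if_pos (Finset.mem_univ k)] at hsum
        zify
        linarith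
    · refine ⟨B, fun c hc k hk => hB c hc k ?_⟩
      have := (p k).isLt
      omega

theorem Appropriate.neg_one_le {r : ℕ} {v : Fin r → ℤ} (hv : Appropriate v) (j : Fin r) :
    -1 ≤ v j := by
  obtain ⟨i, h0, h1, h2⟩ := hv
  rcases lt_trichotomy j i with h | h | h
  · simp [h0 j h]
  · rw [h, h1]
  · linarith [h2 j h]

/-- Lemma `lemele`. Given a finite collection `w_1,…,w_n` of appropriate
vectors in `ℤ^r`, only finitely many non-negative integer linear combinations of these
vectors are appropriate: the set of appropriate vectors of the form `∑ c_i w_i`, `c_i ∈ ℕ`,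
is finite. -/
theorem finitely_many_appropriate_combinations
    {r n : ℕ} (w : Fin n → (Fin r → ℤ)) (hw : ∀ i, Appropriate (w i)) :
    {v : Fin r → ℤ |
      Appropriate v ∧ ∃ c : Fin n → ℕ, v = ∑ i : Fin n, (c i : ℤ) • w i}.Finite := by
  choose p hp using hw
  obtain ⟨B, hB⟩ := exists_bound_coeff_of_neg_one_le w p hp r
  refine ((Set.finite_Iic (fun _ : Fin n => B)).image
    (fun c => ∑ i : Fin n, (c i : ℤ) • w i)).subset ?_
  rintro v ⟨hv, c, rfl⟩
  refine ⟨c, fun k => hB c (fun j => ?_) k (p k).isLt, rfl⟩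
  simpa [Finset.sum_apply] using hv.neg_one_le j
end
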